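/- Fix ε > 0 and δ ∈ (0,1), and suppose that for all integers n and a with ε√n − 1 ≤ a ≤ 2ε√n one has R(n,a) ≤ p(n)^δ, where R(n,a) is the number of partitions of n not representing a. Then for all sufficiently large n, for every integer j with 2 ≤ j ≤ 2⌊√n/2⌋ (assuming ε < 1), every integer a with (j/2)ε√n ≤ a ≤ ((j+1)/2)ε√n satisfies R(n,a) ≤ (2p(ε√n))^{j−2} p(n)^δ. -/

import Mathlib

def Represents (P : Multiset ℕ) (a : ℕ) : Prop :=
  ∃ s ≤ P, s.sum = a

/-- `p n`: number of partitions of `n`. -/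
noncomputable def p (n : ℕ) : ℕ := Nat.card (Nat.Partition n)

/-- `R n a`: number of partitions of `n` not representing `a`. -/
noncomputable def R (n a : ℕ) : ℕ :=
  Nat.card {π : Nat.Partition n // ¬ Represents π.parts a}

lemma p_pos (n : ℕ) : 1 ≤ p n := by
  unfold p
  exact Nat.card_pos

lemma p_mono {m n : ℕ} (h : m ≤ n) : p m ≤ p n := by
  unfold p
  refine Nat.card_le_card_of_injective
    (fun π : Nat.Partition m => (⟨π.parts + Multiset.replicate (n - m) 1, ?_, ?_⟩ : Nat.Partition n)) ?_
  · intro i hi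
    rcases Multiset.mem_add.1 hi with hi | hi
    · exact π.parts_pos hi
    · rw [Multiset.eq_of_mem_replicate hi]; exact Nat.one_pos
  · rw [Multiset.sum_add, π.parts_sum, Multiset.sum_replicate]
    simp; omega
  · intro π ρ hh
    have := congrArg Nat.Partition.parts hh
    exact Nat.Partition.ext (by simpa using this)

lemma R_split (n a b : ℕ) (hb : b ≤ a) : R n a ≤ R n b + p b * R (n - b) (a - b) := by
  classical
  unfold R p
  rw [← Nat.card_prod, ← Nat.card_sum]
  have key : ∀ π : {π : Nat.Partition n // ¬ Represents π.parts a},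
      ∃ y : {π : Nat.Partition n // ¬ Represents π.parts b} ⊕
        (Nat.Partition b × {π : Nat.Partition (n - b) // ¬ Represents π.parts (a - b)}),
        Sum.elim (fun z => z.1.parts) (fun z => z.1.parts + z.2.1.parts) y = π.1.parts := by
    rintro ⟨π, hπ⟩
    by_cases h : Represents π.parts b
    · obtain ⟨s, hs, hsum⟩ := h
      have hadd : s + (π.parts - s) = π.parts := add_tsub_cancel_of_le hs
      refine ⟨Sum.inr ⟨⟨s, fun {i} hi => π.parts_pos (Multiset.mem_of_le hs hi), hsum⟩,
        ⟨⟨π.parts - s, fun {i} hi =>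
          π.parts_pos (Multiset.mem_of_le (Multiset.sub_le_self _ _) hi), ?_⟩, ?_⟩⟩, ?_⟩
      · have := congrArg Multiset.sum hadd
        rw [Multiset.sum_add, hsum, π.parts_sum] at this
        omega
      · rintro ⟨u, hu, husum⟩
        refine hπ ⟨s + u, ?_, ?_⟩
        · rw [← hadd]; gcongr
        · rw [Multiset.sum_add, hsum, husum]; omega
      · exact hadd
    · exact ⟨Sum.inl ⟨π, h⟩, rfl⟩
  choose f hf using key
  refine Nat.card_le_card_of_injective f ?_
  intro π ρ h
  have h1 := hf π
  rw [h, hf ρ] at h1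
  exact Subtype.ext (Nat.Partition.ext h1.symm)

lemma main_ind (ε δ : ℝ) (hε : 0 < ε) (hδ0 : 0 < δ)
    (H : ∀ n a : ℕ, ε * Real.sqrt n - 1 ≤ a → (a : ℝ) ≤ 2 * ε * Real.sqrt n →
      (R n a : ℝ) ≤ (p n : ℝ) ^ δ) (n D : ℕ) (L : ℝ) (hL : L ≤ ε * Real.sqrt D) (t : ℕ) :
    ∀ a : ℕ, D + a ≤ n → ε * Real.sqrt (D + a : ℕ) - 1 ≤ a → (a : ℝ) ≤ 2 * L + t * (L - 1) →
      (R (D + a) a : ℝ) ≤ (2 * p ⌊ε * Real.sqrt n⌋₊ : ℝ) ^ t * (p n : ℝ) ^ δ := by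
  have hp1 : (1 : ℝ) ≤ p ⌊ε * Real.sqrt n⌋₊ := by exact_mod_cast p_pos _
  have hmono : ∀ a : ℕ, D ≤ a → L ≤ ε * Real.sqrt a := fun a ha => hL.trans (by gcongr)
  have hpd : ∀ k : ℕ, k ≤ n → (p k : ℝ) ^ δ ≤ (p n : ℝ) ^ δ := fun k hk =>
    Real.rpow_le_rpow (by positivity) (by exact_mod_cast p_mono hk) hδ0.le
  have hone : ∀ t : ℕ, (1 : ℝ) ≤ (2 * p ⌊ε * Real.sqrt n⌋₊ : ℝ) ^ t := fun t =>
    one_le_pow₀ (by linarith)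
  have hnn : (0 : ℝ) ≤ (p n : ℝ) ^ δ := by positivity
  have direct : ∀ t a : ℕ, D + a ≤ n → ε * Real.sqrt (D + a : ℕ) - 1 ≤ a →
      (a : ℝ) ≤ 2 * ε * Real.sqrt (D + a : ℕ) →
      (R (D + a) a : ℝ) ≤ (2 * p ⌊ε * Real.sqrt n⌋₊ : ℝ) ^ t * (p n : ℝ) ^ δ := by
    intro t a h1 h2 h3
    calc _ ≤ _ := H _ _ h2 h3
      _ ≤ _ := hpd _ h1
      _ ≤ _ := le_mul_of_one_le_left hnn (hone t)
  induction t with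
  | zero =>
    intro a h1 h2 h3
    have := hmono (D + a) (by omega)
    exact direct 0 a h1 h2 (by push_cast at *; linarith)
  | succ t ih =>
    intro a h1 h2 h3
    by_cases hc : (a : ℝ) ≤ 2 * ε * Real.sqrt (D + a : ℕ)
    · exact direct _ a h1 h2 hc
    push Not at hc
    set m := ε * Real.sqrt (D + a : ℕ) with hm
    have hm0 : 0 ≤ m := by positivity
    have hLm : L ≤ m := hmono (D + a) (by omega)
    set b := ⌊m⌋₊ with hbdef
    have hbm : (b : ℝ) ≤ m := Nat.floor_le hm0
    have hmb : m < b + 1 := Nat.lt_floor_add_one m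
    have hba : b ≤ a := by
      have : (b : ℝ) ≤ a := by linarith
      exact_mod_cast this
    have hs := R_split (D + a) a b hba
    have e : D + a - b = D + (a - b) := by omega
    rw [e] at hs
    have hs' : (R (D + a) a : ℝ) ≤ R (D + a) b + p b * R (D + (a - b)) (a - b) := by
      exact_mod_cast hs
    have hcast : ((a - b : ℕ) : ℝ) = a - b := Nat.cast_sub hba
    have hq : ε * Real.sqrt (D + (a - b) : ℕ) ≤ m := by
      rw [hm]; gcongr; omega
    have h4 := ih (a - b) (by omega) (by rw [hcast]; linarith)
      (by rw [hcast]; push_cast at h3; linarith)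
    have h5 : (R (D + a) b : ℝ) ≤ (p n : ℝ) ^ δ :=
      (H _ _ (by linarith) (by linarith)).trans (hpd _ h1)
    have h6 : (p b : ℝ) ≤ p ⌊ε * Real.sqrt n⌋₊ := by
      have : b ≤ ⌊ε * Real.sqrt n⌋₊ := Nat.floor_le_floor (by rw [hm]; gcongr)
      exact_mod_cast p_mono this
    set P : ℝ := (p ⌊ε * Real.sqrt n⌋₊ : ℝ) with hP
    set X : ℝ := (2 * P) ^ t * (p n : ℝ) ^ δ with hX
    have hX0 : 0 ≤ X := by positivity
    have h7 : (p n : ℝ) ^ δ ≤ X := le_mul_of_one_le_left hnn (hone t)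
    have h8 : (p b : ℝ) * R (D + (a - b)) (a - b) ≤ P * X := by gcongr
    have h9 : (2 * P) ^ (t + 1) * (p n : ℝ) ^ δ = 2 * (P * X) := by rw [hX]; ring
    rw [h9]
    have h10 : X ≤ P * X := le_mul_of_one_le_left hX0 hp1
    linarith

theorem stmt_8 (ε δ : ℝ) (hε : 0 < ε) (hε1 : ε < 1) (hδ0 : 0 < δ) (hδ1 : δ < 1)
    (H : ∀ n a : ℕ, ε * Real.sqrt n - 1 ≤ a → (a : ℝ) ≤ 2 * ε * Real.sqrt n →
      (R n a : ℝ) ≤ (p n : ℝ) ^ δ) :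
    ∃ N : ℕ, ∀ n : ℕ, N ≤ n → ∀ j : ℕ, 2 ≤ j → (j : ℝ) ≤ 2 * ⌊Real.sqrt n / 2⌋ →
      ∀ a : ℕ, (j / 2 : ℝ) * ε * Real.sqrt n ≤ a →
        (a : ℝ) ≤ ((j + 1) / 2 : ℝ) * ε * Real.sqrt n →
        (R n a : ℝ) ≤ (2 * p ⌊ε * Real.sqrt n⌋₊ : ℝ) ^ (j - 2) * (p n : ℝ) ^ δ := by
  obtain ⟨K, hK⟩ := exists_nat_ge (50 + 10 / ε)
  refine ⟨K ^ 2, fun n hn j hj hjn a ha1 ha2 => ?_⟩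
  set s := Real.sqrt n with hs
  have hKs : (K : ℝ) ≤ s := Real.le_sqrt_of_sq_le (by exact_mod_cast hn)
  have hε10 : 0 < 10 / ε := by positivity
  have hs50 : 50 ≤ s := by linarith
  have hm10 : 10 ≤ ε * s := by
    have : 10 / ε ≤ s := by linarith
    rw [div_le_iff₀ hε] at this; linarith
  have hss : s * s = n := Real.mul_self_sqrt (by positivity)
  have hjs : (j : ℝ) ≤ s := by
    have := Int.floor_le (s / 2); linarith
  have hj2 : (2 : ℝ) ≤ j := by exact_mod_cast hj
  have ha1' : ε * s ≤ a := by nlinarith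
  rcases hj.eq_or_lt with rfl | hj3
  · have h := H n a (by linarith) (by push_cast at ha2; linarith)
    simpa using h
  have hj3' : (3 : ℝ) ≤ j := by exact_mod_cast hj3
  have ha3 : (a : ℝ) ≤ (s + 1) / 2 * s := by
    calc (a : ℝ) ≤ ((j + 1) / 2 : ℝ) * ε * s := ha2
      _ ≤ ((s + 1) / 2 : ℝ) * 1 * s := by gcongr
      _ = _ := by ring
  have han : a ≤ n := by
    have : (a : ℝ) ≤ n := by rw [← hss]; nlinarith
    exact_mod_cast this
  obtain ⟨D, rfl⟩ : ∃ D, n = D + a := ⟨n - a, by omega⟩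
  have hD : 0.7 * s ≤ Real.sqrt D := by
    apply Real.le_sqrt_of_sq_le
    push_cast at hss
    nlinarith
  have hc : ((j - 2 : ℕ) : ℝ) = j - 2 := by rw [Nat.cast_sub hj]; norm_num
  refine main_ind ε δ hε hδ0 H (D + a) D (0.7 * (ε * s)) ?_ (j - 2) a le_rfl ?_ ?_
  · nlinarith
  · linarith
  · rw [hc]
    nlinarith [mul_nonneg (sub_nonneg.2 hj3') (sub_nonneg.2 hm10)]
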